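/- The quotient P(V_{1,4})/(SL₂(ℂ)×SL₂(ℂ)) is rational: the field of SL₂×SL₂-invariant rational functions on the 9-dimensional projective space P(V_{1,4}) of bidegree (1,4) biforms is a purely transcendental extension of ℂ of transcendence degree 3. -/

import Mathlib

set_option synthInstance.maxHeartbeats 1000000
set_option maxHeartbeats 1000000
noncomputable section
open MvPolynomial

/-- The field of invariant rational functions: the subfield of the fraction field of `R`
consisting of elements fixed by a family of `ℂ`-algebra endomorphisms of `R`. -/
def invariantField (R : Type*) [CommRing R] [IsDomain R] [Algebra ℂ R]
    {ι : Type*} (φ : ι → (R →ₐ[ℂ] R)) : IntermediateField ℂ (FractionRing R) where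
  carrier := {x | ∃ f g : R, g ≠ 0 ∧
      x = algebraMap R (FractionRing R) f / algebraMap R (FractionRing R) g ∧
      ∀ i, φ i f * g = φ i g * f}
  mul_mem' := by
    rintro x y ⟨f, g, hg, rfl, hf⟩ ⟨p, q, hq, rfl, hp⟩
    exact ⟨f * p, g * q, mul_ne_zero hg hq,
      by rw [map_mul, map_mul, div_mul_div_comm],
      fun i => by
        simp only [map_mul]
        linear_combination (φ i p * q) * hf i + (φ i g * f) * hp i⟩
  one_mem' := ⟨1, 1, one_ne_zero, by simp, fun i => rfl⟩
  add_mem' := by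
    rintro x y ⟨f, g, hg, rfl, hf⟩ ⟨p, q, hq, rfl, hp⟩
    have hg' : algebraMap R (FractionRing R) g ≠ 0 :=
      fun h => hg ((map_eq_zero_iff _ (IsFractionRing.injective R (FractionRing R))).mp h)
    have hq' : algebraMap R (FractionRing R) q ≠ 0 :=
      fun h => hq ((map_eq_zero_iff _ (IsFractionRing.injective R (FractionRing R))).mp h)
    refine ⟨f * q + g * p, g * q, mul_ne_zero hg hq, ?_, fun i => ?_⟩
    · rw [map_add, map_mul, map_mul, map_mul, div_add_div _ _ hg' hq']
    · simp only [map_add, map_mul]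
      linear_combination (φ i q * q) * hf i + (φ i g * g) * hp i
  zero_mem' := ⟨0, 1, one_ne_zero, by simp, fun i => by simp⟩
  algebraMap_mem' := fun c =>
    ⟨algebraMap ℂ R c, 1, one_ne_zero,
      by rw [map_one, div_one, ← IsScalarTower.algebraMap_apply],
      fun i => by simp [AlgHom.commutes]⟩
  inv_mem' := by
    rintro x ⟨f, g, hg, rfl, hf⟩
    by_cases hf0 : f = 0
    · exact ⟨0, 1, one_ne_zero, by simp [hf0], fun i => by simp⟩
    · exact ⟨g, f, hf0, by rw [inv_div], fun i => (hf i).symm⟩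

abbrev SL2 := Matrix.SpecialLinearGroup (Fin 2) ℂ

/-- The action of `SL₂(ℂ)` on binary forms by linear substitution of the variables. -/
def sub1 (g : SL2) : MvPolynomial (Fin 2) ℂ →ₐ[ℂ] MvPolynomial (Fin 2) ℂ :=
  aeval fun i => ∑ j, C (g.1 i j) * X j

/-- The matrix of the action of `g` on `V_d` in the basis of monomials `X^i Y^(d-i)`. -/
def repMat (d : ℕ) (g : SL2) (i j : Fin (d + 1)) : ℂ :=
  coeff (Finsupp.single 0 (i : ℕ) + Finsupp.single 1 (d - (i : ℕ)))
    (sub1 g (X 0 ^ (j : ℕ) * X 1 ^ (d - (j : ℕ))))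

/-- The endomorphism of the coordinate ring of `V_{a,b} = V_a ⊗ V_b` induced by
`(g, h) ∈ SL₂ × SL₂` together with the scaling by `t` (so that invariance under the
scalings expresses that a rational function descends to the projectivization). -/
def coordHomAB (a b : ℕ) (g h : SL2) (t : ℂˣ) :
    MvPolynomial (Fin (a + 1) × Fin (b + 1)) ℂ →ₐ[ℂ]
      MvPolynomial (Fin (a + 1) × Fin (b + 1)) ℂ :=
  aeval fun p => (t : ℂ) • ∑ q, C (repMat a g p.1 q.1 * repMat b h p.2 q.2) * X q

/-- The field `ℂ(P(V_{a,b}))^{SL₂×SL₂}` of `SL₂(ℂ) × SL₂(ℂ)`-invariant rational functions on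
the projective space of biforms of bidegree `(a,b)`, realized as the field of rational
functions in the coefficient coordinates (indexed by `Fin (a+1) × Fin (b+1)`) that are
invariant under the induced linear action and under scaling. -/
def invFieldAB (a b : ℕ) :
    IntermediateField ℂ (FractionRing (MvPolynomial (Fin (a + 1) × Fin (b + 1)) ℂ)) :=
  invariantField _ fun γ : SL2 × SL2 × ℂˣ => coordHomAB a b γ.1 γ.2.1 γ.2.2



def r4 {A : Type*} [CommRing A] (a b c d : A) (i j : Fin 5) : A :=
  (![![d^4, b*d^3, b^2*d^2, b^3*d, b^4],
     ![4*c*d^3, a*d^3+3*b*c*d^2, 2*a*b*d^2+2*b^2*c*d, 3*a*b^2*d+b^3*c, 4*a*b^3],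
     ![6*c^2*d^2, 3*a*c*d^2+3*b*c^2*d, a^2*d^2+4*a*b*c*d+b^2*c^2, 3*a^2*b*d+3*a*b^2*c, 6*a^2*b^2],
     ![4*c^3*d, 3*a*c^2*d+b*c^3, 2*a^2*c*d+2*a*b*c^2, a^3*d+3*a^2*b*c, 4*a^3*b],
     ![c^4, a*c^3, a^2*c^2, a^3*c, a^4]] : Fin 5 → Fin 5 → A) i j

def r1 {A : Type*} [CommRing A] (a b c d : A) (i j : Fin 2) : A :=
  (![![d, b], ![c, a]] : Fin 2 → Fin 2 → A) i j

lemma mono_coeff (d : ℕ) (c : Fin (d+1) → ℂ) (i : Fin (d+1)) :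
    coeff (Finsupp.single (0 : Fin 2) (i : ℕ) + Finsupp.single 1 (d - (i : ℕ)))
      (∑ k : Fin (d+1), C (c k) * (X 0 ^ (k : ℕ) * X 1 ^ (d - (k : ℕ)))) = c i := by
  rw [coeff_sum, Finset.sum_eq_single i]
  · rw [coeff_C_mul, X_pow_eq_monomial, X_pow_eq_monomial, monomial_mul, coeff_monomial]
    simp
  · intro k _ hk
    rw [coeff_C_mul, X_pow_eq_monomial, X_pow_eq_monomial, monomial_mul, coeff_monomial, if_neg,
      mul_zero]
    intro h
    have := DFunLike.congr_fun h 0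
    simp at this
    exact hk (Fin.ext this)
  · simp

lemma repMat_four (g : SL2) (i j : Fin 5) :
    repMat 4 g i j = r4 (g.1 0 0) (g.1 0 1) (g.1 1 0) (g.1 1 1) i j := by
  have h : sub1 g (X 0 ^ (j : ℕ) * X 1 ^ (4 - (j : ℕ))) =
      ∑ k : Fin (4+1), C (r4 (g.1 0 0) (g.1 0 1) (g.1 1 0) (g.1 1 1) k j) *
        (X 0 ^ (k : ℕ) * X 1 ^ (4 - (k : ℕ))) := by
    have c2 : (C 2 : MvPolynomial (Fin 2) ℂ) = 2 := map_ofNat C 2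
    have c3 : (C 3 : MvPolynomial (Fin 2) ℂ) = 3 := map_ofNat C 3
    have c4 : (C 4 : MvPolynomial (Fin 2) ℂ) = 4 := map_ofNat C 4
    have c6 : (C 6 : MvPolynomial (Fin 2) ℂ) = 6 := map_ofNat C 6
    fin_cases j <;>
      simp [sub1, r4, Fin.sum_univ_five, Fin.sum_univ_two, c2, c3, c4, c6] <;> ring
  rw [repMat, h]
  exact mono_coeff 4 (fun k => r4 (g.1 0 0) (g.1 0 1) (g.1 1 0) (g.1 1 1) k j) i

lemma repMat_one (g : SL2) (i j : Fin 2) :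
    repMat 1 g i j = r1 (g.1 0 0) (g.1 0 1) (g.1 1 0) (g.1 1 1) i j := by
  have h : sub1 g (X 0 ^ (j : ℕ) * X 1 ^ (1 - (j : ℕ))) =
      ∑ k : Fin (1+1), C (r1 (g.1 0 0) (g.1 0 1) (g.1 1 0) (g.1 1 1) k j) *
        (X 0 ^ (k : ℕ) * X 1 ^ (1 - (k : ℕ))) := by
    fin_cases j <;> simp [sub1, r1, Fin.sum_univ_two] <;> ring
  rw [repMat, h]
  exact mono_coeff 1 (fun k => r1 (g.1 0 0) (g.1 0 1) (g.1 1 0) (g.1 1 1) k j) i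

/-- new coefficients of `f(ax+by,cx+dy)` -/
def hf {A : Type*} [CommRing A] (a b c d : A) (v : Fin 5 → A) : Fin 5 → A :=
  fun i => ∑ j, r4 a b c d i j * v j

abbrev VV := Fin (1+1) × Fin (4+1) → ℂ

def act (g h : SL2) (t : ℂˣ) (v : VV) : VV :=
  fun p => (t : ℂ) * ∑ q, repMat 1 g p.1 q.1 * repMat 4 h p.2 q.2 * v q

lemma eval_coordHom (g h : SL2) (t : ℂˣ) (v : VV) (f : MvPolynomial (Fin (1+1) × Fin (4+1)) ℂ) :
    eval v (coordHomAB 1 4 g h t f) = eval (act g h t v) f := by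
  induction f using MvPolynomial.induction_on with
  | C a => simp [coordHomAB]
  | add p q hp hq => simp [hp, hq]
  | mul_X p i hp =>
    rw [map_mul, map_mul, hp, map_mul]
    congr 1
    simp [coordHomAB, act, smul_eval]

lemma act_apply (g h : SL2) (t : ℂˣ) (v : VV) (r : Fin 2) (i : Fin 5) :
    act g h t v (r, i) = t * (
      r1 (g.1 0 0) (g.1 0 1) (g.1 1 0) (g.1 1 1) r 0 *
        hf (h.1 0 0) (h.1 0 1) (h.1 1 0) (h.1 1 1) (fun j => v (0, j)) i +
      r1 (g.1 0 0) (g.1 0 1) (g.1 1 0) (g.1 1 1) r 1 *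
        hf (h.1 0 0) (h.1 0 1) (h.1 1 0) (h.1 1 1) (fun j => v (1, j)) i) := by
  simp only [act, repMat_one, repMat_four, hf]
  rw [Fintype.sum_prod_type, Fin.sum_univ_two]
  simp only [mul_assoc, mul_add, Finset.mul_sum]

lemma hf_comp {A : Type*} [CommRing A] (a b c d a' b' c' d' : A) (v : Fin 5 → A) :
    hf a b c d (hf a' b' c' d' v) =
      hf (a'*a+b'*c) (a'*b+b'*d) (c'*a+d'*c) (c'*b+d'*d) v := by
  funext i
  fin_cases i <;> simp [hf, r4, Fin.sum_univ_five] <;> ring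

lemma hf_add {A : Type*} [CommRing A] (a b c d x y : A) (v w : Fin 5 → A) (i) :
    hf a b c d (fun j => x * v j + y * w j) i = x * hf a b c d v i + y * hf a b c d w i := by
  simp only [hf, mul_add, Finset.sum_add_distrib, Finset.mul_sum]
  congr 1 <;> exact Finset.sum_congr rfl fun j _ => by ring

section cov
variable {A : Type*} [CommRing A]

def cQ (f g : Fin 5 → A) : Fin 3 → A :=
  ![2*(f 3*g 0 - f 0*g 3) - (f 2*g 1 - f 1*g 2),
    8*(f 4*g 0 - f 0*g 4) - (f 3*g 1 - f 1*g 3),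
    2*(f 4*g 1 - f 1*g 4) - (f 3*g 2 - f 2*g 3)]

def cB (q : Fin 3 → A) (f : Fin 5 → A) : Fin 3 → A :=
  ![12*q 2*f 0 - 3*q 1*f 1 + 2*q 0*f 2,
    6*q 2*f 1 - 4*q 1*f 2 + 6*q 0*f 3,
    2*q 2*f 2 - 3*q 1*f 3 + 12*q 0*f 4]

def cP (q u : Fin 3 → A) : A := 2*q 2*u 0 - q 1*u 1 + 2*q 0*u 2

def cJ (u w : Fin 3 → A) : Fin 3 → A :=
  ![2*(u 1*w 0 - u 0*w 1), 4*(u 2*w 0 - u 0*w 2), 2*(u 2*w 1 - u 1*w 2)]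

def cL (n : Fin 5 → A) : A := 12*n 4*n 0 - 3*n 3*n 1 + n 2^2

def h2 (a b c d : A) (u : Fin 3 → A) : Fin 3 → A :=
  ![d^2*u 0 + b*d*u 1 + b^2*u 2,
    2*c*d*u 0 + (a*d+b*c)*u 1 + 2*a*b*u 2,
    c^2*u 0 + a*c*u 1 + a^2*u 2]

lemma cQ_h (a b c d : A) (f g : Fin 5 → A) :
    cQ (hf a b c d f) (hf a b c d g) = fun i => (a*d-b*c)^3 * h2 a b c d (cQ f g) i := by
  funext i
  fin_cases i <;> simp [cQ, hf, h2, r4, Fin.sum_univ_five] <;> ring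

lemma cB_h (a b c d : A) (q : Fin 3 → A) (f : Fin 5 → A) :
    cB (h2 a b c d q) (hf a b c d f) = fun i => (a*d-b*c)^2 * h2 a b c d (cB q f) i := by
  funext i
  fin_cases i <;> simp [cB, hf, h2, r4, Fin.sum_univ_five] <;> ring

lemma cP_h (a b c d : A) (q u : Fin 3 → A) :
    cP (h2 a b c d q) (h2 a b c d u) = (a*d-b*c)^2 * cP q u := by
  simp [cP, h2]; ring

lemma cJ_h (a b c d : A) (q u : Fin 3 → A) :
    cJ (h2 a b c d q) (h2 a b c d u) = fun i => (a*d-b*c) * h2 a b c d (cJ q u) i := by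
  funext i
  fin_cases i <;> simp [cJ, h2] <;> ring

lemma cL_h (a b c d : A) (n : Fin 5 → A) :
    cL (hf a b c d n) = (a*d-b*c)^4 * cL n := by
  simp [cL, hf, r4, Fin.sum_univ_five]; ring

def cD (f g : Fin 5 → A) : A := cP (cQ f g) (cQ f g)

def cC0 (q : Fin 3 → A) (f g : Fin 5 → A) : Fin 3 → A :=
  fun i => cJ (cB q f) (cB q g) i - 36 * cP q q * q i

def cN0 (q : Fin 3 → A) (f g : Fin 5 → A) : Fin 5 → A :=
  fun i => cP q (cB q f) * g i - cP q (cB q g) * f i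

def iJ0 (q : Fin 3 → A) (f g : Fin 5 → A) : A := cP q (cC0 q f g)
def iM0 (q : Fin 3 → A) (f g : Fin 5 → A) : A := cP (cC0 q f g) (cC0 q f g)
def iL0 (q : Fin 3 → A) (f g : Fin 5 → A) : A := cL (cN0 q f g)
def iT0 (q : Fin 3 → A) (f g : Fin 5 → A) : A :=
  cP (cJ (cC0 q f g) q) (cB (cC0 q f g) (cN0 q f g))

lemma h2_lin (a b c d x y : A) (u w : Fin 3 → A) :
    h2 a b c d (fun i => x * u i - y * w i) = fun i => x * h2 a b c d u i - y * h2 a b c d w i := by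
  funext i
  fin_cases i <;> simp [h2] <;> ring

lemma hf_lin (a b c d x y : A) (u w : Fin 5 → A) :
    hf a b c d (fun i => x * u i - y * w i) = fun i => x * hf a b c d u i - y * hf a b c d w i := by
  funext i
  have := hf_add a b c d x (-y) u w i
  simp only [sub_eq_add_neg, ← neg_mul]
  exact this

variable (a b c d : A) (hd : a * d - b * c = 1) (q : Fin 3 → A) (f g : Fin 5 → A)

lemma cC0_h (hd : a * d - b * c = 1) :
    cC0 (h2 a b c d q) (hf a b c d f) (hf a b c d g) = h2 a b c d (cC0 q f g) := by
  have h := h2_lin a b c d 1 (36 * cP q q) (cJ (cB q f) (cB q g)) q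
  simp only [one_mul] at h
  unfold cC0
  rw [h]
  simp only [cB_h, cP_h, hd, one_pow, one_mul, cJ_h]

lemma cN0_h (hd : a * d - b * c = 1) :
    cN0 (h2 a b c d q) (hf a b c d f) (hf a b c d g) = hf a b c d (cN0 q f g) := by
  unfold cN0
  rw [hf_lin]
  simp only [cB_h, cP_h, hd, one_pow, one_mul]

lemma iJ0_h (hd : a * d - b * c = 1) :
    iJ0 (h2 a b c d q) (hf a b c d f) (hf a b c d g) = iJ0 q f g := by
  simp only [iJ0, cC0_h a b c d q f g hd, cP_h, hd, one_pow, one_mul]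
lemma iM0_h (hd : a * d - b * c = 1) :
    iM0 (h2 a b c d q) (hf a b c d f) (hf a b c d g) = iM0 q f g := by
  simp only [iM0, cC0_h a b c d q f g hd, cP_h, hd, one_pow, one_mul]
lemma iL0_h (hd : a * d - b * c = 1) :
    iL0 (h2 a b c d q) (hf a b c d f) (hf a b c d g) = iL0 q f g := by
  simp only [iL0, cN0_h a b c d q f g hd, cL_h, hd, one_pow, one_mul]
lemma iT0_h (hd : a * d - b * c = 1) :
    iT0 (h2 a b c d q) (hf a b c d f) (hf a b c d g) = iT0 q f g := by
  simp only [iT0, cC0_h a b c d q f g hd, cN0_h a b c d q f g hd, cJ_h, cB_h, cP_h, hd,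
    one_pow, one_mul]

lemma cQ_row (x y z w : A) :
    cQ (fun i => x * f i + y * g i) (fun i => z * f i + w * g i) =
      fun i => (x*w-y*z) * cQ f g i := by
  funext i
  fin_cases i <;> simp [cQ] <;> ring

lemma cC0_row (e x y z w : A) (he : e = x*w-y*z) :
    cC0 (fun i => e * q i) (fun i => x * f i + y * g i) (fun i => z * f i + w * g i) =
      fun i => e^3 * cC0 q f g i := by
  subst he
  funext i
  fin_cases i <;> simp [cC0, cB, cJ, cP] <;> ring

lemma cN0_row (e x y z w : A) (he : e = x*w-y*z) :
    cN0 (fun i => e * q i) (fun i => x * f i + y * g i) (fun i => z * f i + w * g i) =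
      fun i => e^3 * cN0 q f g i := by
  subst he
  funext i
  simp [cN0, cB, cP]; ring

variable (e x y z w : A)
lemma iJ0_row (he : e = x*w-y*z) :
    iJ0 (fun i => e * q i) (fun i => x * f i + y * g i) (fun i => z * f i + w * g i) =
      e^4 * iJ0 q f g := by
  simp only [iJ0, cC0_row q f g e x y z w he]
  simp only [cP]; ring
lemma iM0_row (he : e = x*w-y*z) :
    iM0 (fun i => e * q i) (fun i => x * f i + y * g i) (fun i => z * f i + w * g i) =
      e^6 * iM0 q f g := by
  simp only [iM0, cC0_row q f g e x y z w he]
  simp only [cP]; ring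
lemma iL0_row (he : e = x*w-y*z) :
    iL0 (fun i => e * q i) (fun i => x * f i + y * g i) (fun i => z * f i + w * g i) =
      e^6 * iL0 q f g := by
  simp only [iL0, cN0_row q f g e x y z w he]
  simp only [cL]; ring
lemma iT0_row (he : e = x*w-y*z) :
    iT0 (fun i => e * q i) (fun i => x * f i + y * g i) (fun i => z * f i + w * g i) =
      e^10 * iT0 q f g := by
  simp only [iT0, cC0_row q f g e x y z w he, cN0_row q f g e x y z w he]
  simp only [cP, cJ, cB, Matrix.cons_val]; ring

def nd (f g : Fin 5 → A) : A := (iJ0 (cQ f g) f g)^6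
def n0 (f g : Fin 5 → A) : A :=
  9 * ((iJ0 (cQ f g) f g)^2 - iM0 (cQ f g) f g * cD f g) * (iJ0 (cQ f g) f g)^4
def n1 (f g : Fin 5 → A) : A :=
  54 * iT0 (cQ f g) f g * cD f g * (iJ0 (cQ f g) f g)^3 + 6 * n0 f g
def n2 (f g : Fin 5 → A) : A :=
  (9 * ((iJ0 (cQ f g) f g)^2 - iM0 (cQ f g) f g * cD f g))^2 *
  (9 * ((iJ0 (cQ f g) f g)^2 - iM0 (cQ f g) f g * cD f g) + 432 * iL0 (cQ f g) f g * cD f g)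

lemma cD_h (hd : a * d - b * c = 1) : cD (hf a b c d f) (hf a b c d g) = cD f g := by
  simp only [cD, cQ_h, cP_h, hd, one_pow, one_mul]
lemma cQ_h' (hd : a * d - b * c = 1) :
    cQ (hf a b c d f) (hf a b c d g) = h2 a b c d (cQ f g) := by
  simp only [cQ_h, hd, one_pow, one_mul]
lemma cD_row (he : e = x*w-y*z) :
    cD (fun i => x * f i + y * g i) (fun i => z * f i + w * g i) = e^2 * cD f g := by
  simp only [cD, cQ_row, ← he]
  simp only [cP]; ring

lemma nn_h (hd : a * d - b * c = 1) :
    nd (hf a b c d f) (hf a b c d g) = nd f g ∧ n0 (hf a b c d f) (hf a b c d g) = n0 f g ∧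
    n1 (hf a b c d f) (hf a b c d g) = n1 f g ∧ n2 (hf a b c d f) (hf a b c d g) = n2 f g ∧
    cD (hf a b c d f) (hf a b c d g) = cD f g := by
  simp only [nd, n0, n1, n2, cQ_h' a b c d f g hd, cD_h a b c d f g hd, iJ0_h a b c d _ f g hd,
    iM0_h a b c d _ f g hd, iL0_h a b c d _ f g hd, iT0_h a b c d _ f g hd, and_self]

lemma nn_row (he : e = x*w-y*z) :
    nd (fun i => x * f i + y * g i) (fun i => z * f i + w * g i) = e^24 * nd f g ∧
    n0 (fun i => x * f i + y * g i) (fun i => z * f i + w * g i) = e^24 * n0 f g ∧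
    n1 (fun i => x * f i + y * g i) (fun i => z * f i + w * g i) = e^24 * n1 f g ∧
    n2 (fun i => x * f i + y * g i) (fun i => z * f i + w * g i) = e^24 * n2 f g ∧
    cD (fun i => x * f i + y * g i) (fun i => z * f i + w * g i) = e^2 * cD f g := by
  simp only [nd, n0, n1, n2, cQ_row, ← he, cD_row f g e x y z w he, iJ0_row _ f g e x y z w he,
    iM0_row _ f g e x y z w he, iL0_row _ f g e x y z w he, iT0_row _ f g e x y z w he]
  refine ⟨?_, ?_, ?_, ?_, trivial⟩ <;> ring

end cov

lemma act_act (g h g' h' : SL2) (t t' : ℂˣ) (v : VV) :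
    act g h t (act g' h' t' v) = act (g' * g) (h' * h) (t' * t) v := by
  funext ⟨r, i⟩
  simp only [act_apply]
  have e : ∀ r : Fin 2, (fun j => act g' h' t' v (r, j)) = fun j =>
      (t' * r1 (g'.1 0 0) (g'.1 0 1) (g'.1 1 0) (g'.1 1 1) r 0) *
        hf (h'.1 0 0) (h'.1 0 1) (h'.1 1 0) (h'.1 1 1) (fun j => v (0, j)) j +
      (t' * r1 (g'.1 0 0) (g'.1 0 1) (g'.1 1 0) (g'.1 1 1) r 1) *
        hf (h'.1 0 0) (h'.1 0 1) (h'.1 1 0) (h'.1 1 1) (fun j => v (1, j)) j := by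
    intro r
    funext j
    rw [act_apply]; ring
  simp only [act_apply] at e
  rw [e, e, hf_add, hf_add, hf_comp, hf_comp]
  simp only [Matrix.SpecialLinearGroup.coe_mul, Matrix.mul_apply, Fin.sum_univ_two, Units.val_mul]
  fin_cases r <;> simp [r1] <;> ring

lemma hf_one {A : Type*} [CommRing A] (v : Fin 5 → A) : hf 1 0 0 1 v = v := by
  funext i
  fin_cases i <;> simp [hf, r4, Fin.sum_univ_five]

lemma act_one (v : VV) : act 1 1 1 v = v := by
  funext ⟨r, i⟩
  rw [act_apply]
  simp only [Matrix.SpecialLinearGroup.coe_one, Matrix.one_apply_eq, Units.val_one,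
    Matrix.one_apply_ne (show (0 : Fin 2) ≠ 1 by decide),
    Matrix.one_apply_ne (show (1 : Fin 2) ≠ 0 by decide), hf_one]
  fin_cases r <;> simp [r1]

def RelV (v w : VV) : Prop := ∃ g h t, act g h t v = w

lemma RelV.trans {u v w : VV} (h1 : RelV u v) (h2 : RelV v w) : RelV u w := by
  obtain ⟨g, h, t, rfl⟩ := h1
  obtain ⟨g', h', t', rfl⟩ := h2
  exact ⟨_, _, _, (act_act ..).symm⟩

lemma RelV.symm {u v : VV} (h1 : RelV u v) : RelV v u := by
  obtain ⟨g, h, t, rfl⟩ := h1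
  refine ⟨g⁻¹, h⁻¹, t⁻¹, ?_⟩
  rw [act_act, mul_inv_cancel, mul_inv_cancel, mul_inv_cancel, act_one]

lemma exSL (a b c d : ℂ) (hd : a * d - b * c = 1) :
    ∃ g : SL2, g.1 0 0 = a ∧ g.1 0 1 = b ∧ g.1 1 0 = c ∧ g.1 1 1 = d :=
  ⟨⟨!![a, b; c, d], by rw [Matrix.det_fin_two_of]; exact hd⟩, rfl, rfl, rfl, rfl⟩

lemma RelV_h (a b c d : ℂ) (hd : a * d - b * c = 1) (v : VV) :
    RelV v (fun p => hf a b c d (fun j => v (p.1, j)) p.2) := by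
  obtain ⟨h, h1, h2, h3, h4⟩ := exSL a b c d hd
  refine ⟨1, h, 1, ?_⟩
  funext ⟨r, i⟩
  rw [act_apply, h1, h2, h3, h4]
  simp only [Matrix.SpecialLinearGroup.coe_one, Matrix.one_apply_eq, Units.val_one,
    Matrix.one_apply_ne (show (0 : Fin 2) ≠ 1 by decide),
    Matrix.one_apply_ne (show (1 : Fin 2) ≠ 0 by decide)]
  fin_cases r <;> simp [r1]

lemma RelV_row (x y z w : ℂ) (hd : x * w - y * z ≠ 0) (v v' : VV)
    (h1 : ∀ i, v' (1, i) = x * v (1, i) + y * v (0, i))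
    (h0 : ∀ i, v' (0, i) = z * v (1, i) + w * v (0, i)) : RelV v v' := by
  obtain ⟨t, ht⟩ := IsAlgClosed.exists_pow_nat_eq (x * w - y * z) (n := 2) (by norm_num)
  have ht0 : t ≠ 0 := by rintro rfl; apply hd; rw [← ht]; norm_num
  obtain ⟨g, g1, g2, g3, g4⟩ := exSL (x/t) (z/t) (y/t) (w/t) (by field_simp; rw [ht]; ring)
  refine ⟨g, 1, Units.mk0 t ht0, ?_⟩
  funext ⟨r, i⟩
  rw [act_apply, g1, g2, g3, g4]
  simp only [Matrix.SpecialLinearGroup.coe_one, Matrix.one_apply_eq, Units.val_mk0,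
    Matrix.one_apply_ne (show (0 : Fin 2) ≠ 1 by decide),
    Matrix.one_apply_ne (show (1 : Fin 2) ≠ 0 by decide), hf_one]
  fin_cases r
  · simp [r1, h0]; field_simp; ring
  · simp [r1, h1]; field_simp; ring

def slF {A : Type*} [CommRing A] (m r s : A) : Fin 5 → A :=
  ![0, (r-2*m)*m^4*r, m^2*r^2*s, m^3*r*s, m^2*r*s]
def slG {A : Type*} [CommRing A] (m r s : A) : Fin 5 → A :=
  ![m^2*r*s, m^2*r*s, r*s^2, (s-2*m)*m*s, 0]

def sl {A : Type*} [CommRing A] (m r s : A) : Fin (1+1) × Fin (4+1) → A :=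
  fun p => (![slG m r s, slF m r s] : Fin 2 → Fin 5 → A) p.1 p.2

lemma slice_vals (k a b c a' b' c' : ℂ) (f g : Fin 5 → ℂ)
    (hf : f = ![0, k*c, k*b, k*a, k]) (hg : g = ![k, k*a', k*b', k*c', 0])
    (e1 : a*b' - b*c' = 2*a') (e2 : b*a' - c*b' = 2*a) :
    ∃ P, P = k^2*(8 - (a*a'-c*c')) ∧ cD f g = -P^2 ∧ nd f g = (288*P^3*k^2)^6 ∧
      n0 f g = a*a' * nd f g ∧ n1 f g = (a^2*b'+a'^2*b) * nd f g ∧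
      n2 f g = (a*a')^2*(b*b') * nd f g := by
  obtain ⟨P, hP⟩ : ∃ P, P = k^2*(8 - (a*a'-c*c')) := ⟨_, rfl⟩
  have hQ : cQ f g = ![0, P, 0] := by
    subst hf hg hP
    funext i
    fin_cases i <;> simp [cQ]
    · linear_combination k^2*(-e2)
    · ring
    · linear_combination k^2*(-e1)
  have hD : cD f g = -P^2 := by
    simp [cD, hQ, cP]; ring
  have hC : cC0 (cQ f g) f g = ![48*P^2*k^2*a, 288*P^2*k^2, 48*P^2*k^2*a'] := by
    rw [hQ]
    subst hf hg
    funext i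
    fin_cases i <;> simp [cC0, cJ, cB, cP]
    · linear_combination 24*P^2*k^2*e2
    · rw [hP]; ring
    · linear_combination 24*P^2*k^2*e1
  have hN : cN0 (cQ f g) f g = ![4*P^2*k^2*b, 8*P^2*k^2*a, 0, -8*P^2*k^2*a', -4*P^2*k^2*b'] := by
    rw [hQ]
    subst hf hg
    funext i
    fin_cases i <;> simp [cN0, cB, cP]
    · ring
    · linear_combination 4*P^2*k^2*e2
    · ring
    · linear_combination -4*P^2*k^2*e1
    · ring
  have hJ : iJ0 (cQ f g) f g = -288*P^3*k^2 := by
    rw [iJ0, hC, hQ]; simp [cP]; ring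
  have hM : iM0 (cQ f g) f g = 48^2*P^4*k^4*(4*a*a'-36) := by
    rw [iM0, hC]; simp [cP]; ring
  have hL : iL0 (cQ f g) f g = 192*P^4*k^4*(a*a'-b*b') := by
    rw [iL0, hN]; simp [cL]; ring
  have hT : iT0 (cQ f g) f g = 442368*P^7*k^6*(a^2*b'+a'^2*b-6*a*a') := by
    rw [iT0, hN, hC, hQ]; simp [cP, cJ, cB]; ring
  have hn0 : n0 f g = a*a' * nd f g := by
    rw [n0, nd, hJ, hM, hD]; ring
  refine ⟨P, hP, hD, ?_, hn0, ?_, ?_⟩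
  · rw [nd, hJ]; ring
  · rw [n1, hn0, nd, hJ, hT, hD]; ring
  · rw [n2, nd, hJ, hM, hL, hD]; ring

lemma slice_vals' (m r s : ℂ) (hm : m ≠ 0) (hr : r ≠ 0) (hs : s ≠ 0) :
    n0 (slF m r s) (slG m r s) = m * nd (slF m r s) (slG m r s) ∧
    n1 (slF m r s) (slG m r s) = (r + s) * nd (slF m r s) (slG m r s) ∧
    n2 (slF m r s) (slG m r s) = (r * s) * nd (slF m r s) (slG m r s) := by
  obtain ⟨P, -, -, -, h0, h1, h2⟩ := slice_vals (m^2*r*s) m r ((r-2*m)*m^2/s) 1 (s/m^2)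
    ((s-2*m)/(m*r)) (slF m r s) (slG m r s)
    (by funext i; fin_cases i <;> simp [slF] <;> field_simp)
    (by funext i; fin_cases i <;> simp [slG] <;> field_simp)
    (by field_simp; ring) (by field_simp; ring)
  refine ⟨by rw [h0]; ring, ?_, ?_⟩
  · rw [h1]; congr 1; field_simp; ring
  · rw [h2]; congr 1; field_simp

lemma slice_pt : nd (slF (1:ℂ) 1 1) (slG 1 1 1) ≠ 0 ∧ cD (slF (1:ℂ) 1 1) (slG 1 1 1) ≠ 0 := by
  obtain ⟨P, hP, hD, hn, -⟩ := slice_vals 1 1 1 (-1) 1 1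
    (-1) (slF 1 1 1) (slG 1 1 1)
    (by funext i; fin_cases i <;> simp [slF] <;> norm_num)
    (by funext i; fin_cases i <;> simp [slG] <;> norm_num)
    (by norm_num) (by norm_num)
  rw [hn, hD, hP]
  norm_num

lemma act_nn (g h : SL2) (t : ℂˣ) (v : VV) :
    nd (fun i => act g h t v (1, i)) (fun i => act g h t v (0, i)) =
      ((t:ℂ)^2)^24 * nd (fun i => v (1, i)) (fun i => v (0, i)) ∧
    n0 (fun i => act g h t v (1, i)) (fun i => act g h t v (0, i)) =
      ((t:ℂ)^2)^24 * n0 (fun i => v (1, i)) (fun i => v (0, i)) ∧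
    n1 (fun i => act g h t v (1, i)) (fun i => act g h t v (0, i)) =
      ((t:ℂ)^2)^24 * n1 (fun i => v (1, i)) (fun i => v (0, i)) ∧
    n2 (fun i => act g h t v (1, i)) (fun i => act g h t v (0, i)) =
      ((t:ℂ)^2)^24 * n2 (fun i => v (1, i)) (fun i => v (0, i)) ∧
    cD (fun i => act g h t v (1, i)) (fun i => act g h t v (0, i)) =
      ((t:ℂ)^2)^2 * cD (fun i => v (1, i)) (fun i => v (0, i)) := by
  have hg := g.2
  rw [Matrix.det_fin_two] at hg
  have hh := h.2
  rw [Matrix.det_fin_two] at hh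
  obtain ⟨A1, A2, A3, A4, A5⟩ := nn_h _ _ _ _ (fun i => v (1, i)) (fun i => v (0, i)) hh
  obtain ⟨B1, B2, B3, B4, B5⟩ := nn_row
    (hf (h.1 0 0) (h.1 0 1) (h.1 1 0) (h.1 1 1) (fun j => v (1, j)))
    (hf (h.1 0 0) (h.1 0 1) (h.1 1 0) (h.1 1 1) (fun j => v (0, j)))
    ((t:ℂ)^2) (t * g.1 0 0) (t * g.1 1 0) (t * g.1 0 1) (t * g.1 1 1)
    (by linear_combination (-(t:ℂ)^2) * hg)
  have e1 : (fun i => act g h t v (1, i)) = fun i => t * g.1 0 0 *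
      (hf (h.1 0 0) (h.1 0 1) (h.1 1 0) (h.1 1 1) (fun j => v (1, j))) i +
      t * g.1 1 0 * (hf (h.1 0 0) (h.1 0 1) (h.1 1 0) (h.1 1 1) (fun j => v (0, j))) i := by
    funext i
    rw [act_apply]; simp [r1]; ring
  have e0 : (fun i => act g h t v (0, i)) = fun i => t * g.1 0 1 *
      (hf (h.1 0 0) (h.1 0 1) (h.1 1 0) (h.1 1 1) (fun j => v (1, j))) i +
      t * g.1 1 1 * (hf (h.1 0 0) (h.1 0 1) (h.1 1 0) (h.1 1 1) (fun j => v (0, j))) i := by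
    funext i
    rw [act_apply]; simp [r1]; ring
  rw [e1, e0, B1, B2, B3, B4, B5, A1, A2, A3, A4, A5]
  exact ⟨rfl, rfl, rfl, rfl, rfl⟩

def mkV (f g : Fin 5 → ℂ) : VV := fun p => (![g, f] : Fin 2 → Fin 5 → ℂ) p.1 p.2

lemma norm_to_sl (a b c a' b' c' : ℂ)
    (e1 : a*b' - b*c' = 2*a') (e2 : b*a' - c*b' = 2*a)
    (ha : a ≠ 0) (hb : b ≠ 0) (ha' : a' ≠ 0) (hb' : b' ≠ 0) :
    RelV (mkV ![0, c, b, a, 1] ![1, a', b', c', 0]) (sl (a*a') (b*a'^2) (a^2*b')) := by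
  obtain ⟨u, hu⟩ := IsAlgClosed.exists_pow_nat_eq a' (n := 2) (by norm_num)
  have hu0 : u ≠ 0 := by rintro rfl; apply ha'; rw [← hu]; norm_num
  refine (RelV_h u⁻¹ 0 0 u (by field_simp; ring) _).trans ?_
  have hc : c = (b*a'-2*a)/b' := by field_simp; linear_combination -e2
  have hc' : c' = (a*b'-2*a')/b := by field_simp; linear_combination -e1
  refine RelV_row ((a*a')^2*(b*a'^2)*(a^2*b') * u^4) 0 0 ((a*a')^2*(b*a'^2)*(a^2*b') / u^4)
    ?_ _ _ ?_ ?_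
  · rw [hc, hc'] at *
    subst hu
    simp [ha, hb, hb', hu0]
  · intro i
    subst hc hc' hu
    fin_cases i <;> simp [mkV, sl, slF, hf, r4, Fin.sum_univ_five] <;> field_simp
  · intro i
    subst hc hc' hu
    fin_cases i <;> simp [mkV, sl, slG, hf, r4, Fin.sum_univ_five] <;> field_simp

lemma sl_swap (m r s : ℂ) (hm : m ≠ 0) (hr : r ≠ 0) (hs : s ≠ 0) :
    RelV (sl m r s) (sl m s r) := by
  have h1 := norm_to_sl m r ((r-2*m)*m^2/s) 1 (s/m^2) ((s-2*m)/(m*r))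
    (by field_simp; ring) (by field_simp; ring) hm hr one_ne_zero (by positivity)
  have h2 := norm_to_sl (-1) (s/m^2) (-((s-2*m)/(m*r))) (-m) r (-((r-2*m)*m^2/s))
    (by field_simp; ring) (by field_simp; ring) (by norm_num) (by positivity) (neg_ne_zero.2 hm) hr
  have e1 : sl (m * 1) (r * 1^2) (m^2*(s/m^2)) = sl m r s := by
    congr 1 <;> field_simp
  have e2 : sl (-1 * -m) (s/m^2 * (-m)^2) ((-1)^2*r) = sl m s r := by
    congr 1 <;> field_simp
  rw [e1] at h1
  rw [e2] at h2
  refine h1.symm.trans (RelV.trans ?_ h2)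
  refine (RelV_h 0 1 (-1) 0 (by norm_num) _).trans ?_
  refine RelV_row 0 1 1 0 (by norm_num) _ _ ?_ ?_
  · intro i
    fin_cases i <;> simp [mkV, hf, r4, Fin.sum_univ_five] <;> ring
  · intro i
    fin_cases i <;> simp [mkV, hf, r4, Fin.sum_univ_five] <;> ring

lemma diag_exists (q : Fin 3 → ℂ) (h : cP q q ≠ 0) :
    ∃ a b c d : ℂ, a * d - b * c = 1 ∧ h2 a b c d q 0 = 0 ∧ h2 a b c d q 2 = 0 := by
  by_cases h2' : q 2 = 0
  · have h1 : q 1 ≠ 0 := by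
      intro h1; apply h; simp [cP, h1, h2']
    refine ⟨1, -q 0 / q 1, 0, 1, by norm_num, ?_, ?_⟩
    · simp [h2, h2']; field_simp; ring
    · simp [h2, h2']
  · obtain ⟨e, he⟩ := IsAlgClosed.exists_pow_nat_eq (-cP q q) (n := 2) (by norm_num)
    have he0 : e ≠ 0 := by
      rintro rfl; apply h; linear_combination he
    have he' : e^2 = q 1 ^2 - 4*q 2*q 0 := by rw [he, cP]; ring
    refine ⟨-q 1 + e, (-q 1 - e)/(4*q 2*e), 2*q 2, 2*q 2/(4*q 2*e), by field_simp; ring, ?_, ?_⟩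
    · simp [h2]; field_simp; linear_combination he'
    · simp [h2]; linear_combination q 2 * he'

lemma reduce (v : VV)
    (hn : nd (fun i => v (1, i)) (fun i => v (0, i)) ≠ 0)
    (hD : cD (fun i => v (1, i)) (fun i => v (0, i)) ≠ 0)
    (hn0 : n0 (fun i => v (1, i)) (fun i => v (0, i)) ≠ 0)
    (hn2 : n2 (fun i => v (1, i)) (fun i => v (0, i)) ≠ 0) :
    ∃ m r s : ℂ, m ≠ 0 ∧ r ≠ 0 ∧ s ≠ 0 ∧ RelV v (sl m r s) := by
  obtain ⟨a, b, c, d, hd, q0, q2⟩ := diag_exists _ hD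
  obtain ⟨A1, A2, A3, A4, A5⟩ := nn_h _ _ _ _ (fun i => v (1, i)) (fun i => v (0, i)) hd
  rw [← A1] at hn
  rw [← A2] at hn0
  rw [← A4] at hn2
  rw [← cQ_h' a b c d _ _ hd] at q0 q2
  obtain ⟨f, hf'⟩ : ∃ f, f = hf a b c d (fun i => v (1, i)) := ⟨_, rfl⟩
  obtain ⟨g, hg'⟩ : ∃ g, g = hf a b c d (fun i => v (0, i)) := ⟨_, rfl⟩
  rw [← hf', ← hg'] at q0 q2 hn hn0 hn2
  have R1 : RelV v (mkV f g) := by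
    have := RelV_h a b c d hd v
    convert this using 1
    funext ⟨r, i⟩
    fin_cases r <;> simp [mkV, hf', hg']
  have hp : f 4 * g 0 - f 0 * g 4 ≠ 0 := by
    intro hp
    apply hn
    have : iJ0 (cQ f g) f g = 0 := by
      have hQ : cQ f g = ![0, cQ f g 1, 0] := by
        funext i; fin_cases i
        · exact q0
        · rfl
        · exact q2
      rw [hQ]
      simp [iJ0, cC0, cP, cJ, cB]
      have : cQ f g 1 = - (f 3*g 1 - f 1*g 3) := by
        simp [cQ, hp]
      right; rw [this]; ring
    simp [nd, this]
  obtain ⟨p, hpp⟩ : ∃ p, p = f 4 * g 0 - f 0 * g 4 := ⟨_, rfl⟩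
  rw [← hpp] at hp
  have hdet : p⁻¹ = (g 0/p) * (f 4/p) - (-f 0/p)*(-g 4/p) := by
    field_simp; rw [hpp]; ring
  obtain ⟨B1, B2, B3, B4, B5⟩ := nn_row f g p⁻¹ (g 0/p) (-f 0/p) (-g 4/p) (f 4/p) hdet
  have Bq := cQ_row f g (g 0/p) (-f 0/p) (-g 4/p) (f 4/p)
  obtain ⟨f', hff⟩ : ∃ f', f' = fun i => g 0/p * f i + -f 0/p * g i := ⟨_, rfl⟩
  obtain ⟨g', hgg⟩ : ∃ g', g' = fun i => -g 4/p * f i + f 4/p * g i := ⟨_, rfl⟩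
  rw [← hff, ← hgg] at B1 B2 B4 Bq
  have R2 : RelV (mkV f g) (mkV f' g') := by
    refine RelV_row (g 0/p) (-f 0/p) (-g 4/p) (f 4/p) ?_ _ _ ?_ ?_
    · rw [← hdet]; exact inv_ne_zero hp
    · intro i; simp [mkV, hff]
    · intro i; simp [mkV, hgg]
  have hpe : (p⁻¹)^24 ≠ 0 := pow_ne_zero _ (inv_ne_zero hp)
  have hn' : nd f' g' ≠ 0 := by rw [B1]; exact mul_ne_zero hpe hn
  have hn0' : n0 f' g' ≠ 0 := by rw [B2]; exact mul_ne_zero hpe hn0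
  have hn2' : n2 f' g' ≠ 0 := by rw [B4]; exact mul_ne_zero hpe hn2
  have q0' : cQ f' g' 0 = 0 := by rw [Bq]; simp [q0]
  have q2' : cQ f' g' 2 = 0 := by rw [Bq]; simp [q2]
  have f0 : f' 0 = 0 := by rw [hff]; field_simp; ring
  have f4 : f' 4 = 1 := by rw [hff]; field_simp; rw [hpp]; ring
  have g0 : g' 0 = 1 := by rw [hgg]; field_simp; rw [hpp]; ring
  have g4 : g' 4 = 0 := by rw [hgg]; field_simp; ring
  clear hff hgg
  have ef : f' = ![0, f' 1, f' 2, f' 3, 1] := by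
    funext i; fin_cases i <;> simp [f0, f4]
  have eg : g' = ![1, g' 1, g' 2, g' 3, 0] := by
    funext i; fin_cases i <;> simp [g0, g4]
  have e1 : f' 3 * g' 2 - f' 2 * g' 3 = 2 * g' 1 := by
    simp [cQ, f4, g4] at q2'
    linear_combination -q2'
  have e2 : f' 2 * g' 1 - f' 1 * g' 2 = 2 * f' 3 := by
    simp [cQ, f0, g0] at q0'
    linear_combination -q0'
  obtain ⟨P, -, -, -, k0, -, k2⟩ := slice_vals 1 (f' 3) (f' 2) (f' 1) (g' 1) (g' 2) (g' 3) f' g'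
    (by simpa only [one_mul] using ef) (by simpa only [one_mul] using eg) e1 e2
  rw [k0] at hn0'
  rw [k2] at hn2'
  have ha : f' 3 ≠ 0 := by intro h; simp [h] at hn0'
  have ha' : g' 1 ≠ 0 := by intro h; simp [h] at hn0'
  have hb : f' 2 ≠ 0 := by intro h; simp [h] at hn2'
  have hb' : g' 2 ≠ 0 := by intro h; simp [h] at hn2'
  have R3 := norm_to_sl (f' 3) (f' 2) (f' 1) (g' 1) (g' 2) (g' 3) e1 e2 ha hb ha' hb'
  rw [← ef, ← eg] at R3
  exact ⟨_, _, _, mul_ne_zero ha ha', mul_ne_zero hb (pow_ne_zero _ ha'),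
    mul_ne_zero (pow_ne_zero _ ha) hb', R1.trans (R2.trans R3)⟩

section maps
variable {A B : Type*} [CommRing A] [CommRing B] (φ : A →+* B)

lemma map_cQ (f g : Fin 5 → A) :
    (fun i => φ (cQ f g i)) = cQ (fun i => φ (f i)) (fun i => φ (g i)) := by
  funext i; fin_cases i <;> simp [map_ofNat, cQ]
lemma map_cB (q : Fin 3 → A) (f : Fin 5 → A) :
    (fun i => φ (cB q f i)) = cB (fun i => φ (q i)) (fun i => φ (f i)) := by
  funext i; fin_cases i <;> simp [map_ofNat, cB]
lemma map_cJ (q f : Fin 3 → A) :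
    (fun i => φ (cJ q f i)) = cJ (fun i => φ (q i)) (fun i => φ (f i)) := by
  funext i; fin_cases i <;> simp [map_ofNat, cJ]
lemma map_cP (q f : Fin 3 → A) :
    φ (cP q f) = cP (fun i => φ (q i)) (fun i => φ (f i)) := by
  simp [map_ofNat, cP]
lemma map_cL (n : Fin 5 → A) : φ (cL n) = cL (fun i => φ (n i)) := by
  simp [map_ofNat, cL]
lemma map_cC0 (q : Fin 3 → A) (f g : Fin 5 → A) :
    (fun i => φ (cC0 q f g i)) = cC0 (fun i => φ (q i)) (fun i => φ (f i)) (fun i => φ (g i)) := by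
  funext i
  simp only [cC0, ← map_cB, ← map_cJ, ← map_cP]
  simp [map_ofNat]
lemma map_cN0 (q : Fin 3 → A) (f g : Fin 5 → A) :
    (fun i => φ (cN0 q f g i)) = cN0 (fun i => φ (q i)) (fun i => φ (f i)) (fun i => φ (g i)) := by
  funext i
  simp only [cN0, ← map_cB, ← map_cP]
  simp [map_ofNat]

lemma map_nn (f g : Fin 5 → A) :
    φ (cD f g) = cD (fun i => φ (f i)) (fun i => φ (g i)) ∧
    φ (nd f g) = nd (fun i => φ (f i)) (fun i => φ (g i)) ∧
    φ (n0 f g) = n0 (fun i => φ (f i)) (fun i => φ (g i)) ∧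
    φ (n1 f g) = n1 (fun i => φ (f i)) (fun i => φ (g i)) ∧
    φ (n2 f g) = n2 (fun i => φ (f i)) (fun i => φ (g i)) := by
  have hD : φ (cD f g) = cD (fun i => φ (f i)) (fun i => φ (g i)) := by
    rw [cD, map_cP, map_cQ, cD]
  have hJ : φ (iJ0 (cQ f g) f g) =
      iJ0 (cQ (fun i => φ (f i)) (fun i => φ (g i))) (fun i => φ (f i)) (fun i => φ (g i)) := by
    rw [iJ0, map_cP, map_cC0, map_cQ, iJ0]
  have hM : φ (iM0 (cQ f g) f g) =
      iM0 (cQ (fun i => φ (f i)) (fun i => φ (g i))) (fun i => φ (f i)) (fun i => φ (g i)) := by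
    rw [iM0, map_cP, map_cC0, map_cQ, iM0]
  have hL : φ (iL0 (cQ f g) f g) =
      iL0 (cQ (fun i => φ (f i)) (fun i => φ (g i))) (fun i => φ (f i)) (fun i => φ (g i)) := by
    rw [iL0, map_cL, map_cN0, map_cQ, iL0]
  have hT : φ (iT0 (cQ f g) f g) =
      iT0 (cQ (fun i => φ (f i)) (fun i => φ (g i))) (fun i => φ (f i)) (fun i => φ (g i)) := by
    rw [iT0, map_cP, map_cJ, map_cB, map_cC0, map_cN0, map_cQ, iT0]
  have h0 : φ (n0 f g) = n0 (fun i => φ (f i)) (fun i => φ (g i)) := by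
    simp [map_ofNat, n0, hD, hJ, hM]
  refine ⟨hD, ?_, h0, ?_, ?_⟩
  · simp [map_ofNat, nd, hJ]
  · simp [map_ofNat, n1, h0, hT, hD, hJ]
  · simp [map_ofNat, n2, hD, hJ, hM, hL]
end maps

abbrev RR := MvPolynomial (Fin (1+1) × Fin (4+1)) ℂ
abbrev KK := FractionRing RR
abbrev S3 := MvPolynomial (Fin 3) ℂ

def gF : Fin 5 → RR := fun i => X (1, i)
def gG : Fin 5 → RR := fun i => X (0, i)
def pD : RR := cD gF gG
def pd : RR := nd gF gG
def pn : Fin 3 → RR := ![n0 gF gG, n1 gF gG, n2 gF gG]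
def uu : Fin 3 → KK := fun i => algebraMap RR KK (pn i) / algebraMap RR KK pd

def th (y : Fin 3 → ℂ) : Fin 3 → ℂ := ![y 0, y 1 + y 2, y 1 * y 2]

lemma ev_pD (v : VV) : eval v pD = cD (fun i => v (1, i)) (fun i => v (0, i)) := by
  rw [pD, (map_nn (eval v) gF gG).1]; simp [gF, gG]
lemma ev_pd (v : VV) : eval v pd = nd (fun i => v (1, i)) (fun i => v (0, i)) := by
  rw [pd, (map_nn (eval v) gF gG).2.1]; simp [gF, gG]
lemma ev_pn0 (v : VV) : eval v (pn 0) = n0 (fun i => v (1, i)) (fun i => v (0, i)) := by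
  simp only [pn, Matrix.cons_val]
  rw [(map_nn (eval v) gF gG).2.2.1]; simp [gF, gG]
lemma ev_pn1 (v : VV) : eval v (pn 1) = n1 (fun i => v (1, i)) (fun i => v (0, i)) := by
  simp only [pn, Matrix.cons_val]
  rw [(map_nn (eval v) gF gG).2.2.2.1]; simp [gF, gG]
lemma ev_pn2 (v : VV) : eval v (pn 2) = n2 (fun i => v (1, i)) (fun i => v (0, i)) := by
  simp only [pn, Matrix.cons_val]
  rw [(map_nn (eval v) gF gG).2.2.2.2]; simp [gF, gG]

lemma act_ev (g h : SL2) (t : ℂˣ) (v : VV) :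
    eval (act g h t v) pd = ((t:ℂ)^2)^24 * eval v pd ∧
    ∀ i, eval (act g h t v) (pn i) = ((t:ℂ)^2)^24 * eval v (pn i) := by
  obtain ⟨h1, h2, h3, h4, -⟩ := act_nn g h t v
  refine ⟨by rw [ev_pd, ev_pd, h1], fun i => ?_⟩
  fin_cases i
  · exact (ev_pn0 _).trans (h2.trans (by rw [← ev_pn0]; rfl))
  · exact (ev_pn1 _).trans (h3.trans (by rw [← ev_pn1]; rfl))
  · exact (ev_pn2 _).trans (h4.trans (by rw [← ev_pn2]; rfl))

lemma sl_ev (y : Fin 3 → ℂ) (h0 : y 0 ≠ 0) (h1 : y 1 ≠ 0) (h2 : y 2 ≠ 0) (i : Fin 3) :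
    eval (sl (y 0) (y 1) (y 2)) (pn i) = th y i * eval (sl (y 0) (y 1) (y 2)) pd := by
  obtain ⟨a0, a1, a2⟩ := slice_vals' _ _ _ h0 h1 h2
  rw [ev_pd]
  fin_cases i
  · exact (ev_pn0 _).trans a0
  · exact (ev_pn1 _).trans a1
  · exact (ev_pn2 _).trans a2

lemma generic (v : VV) (h : eval v (pd * pD * pn 0 * pn 2) ≠ 0) :
    ∃ y : Fin 3 → ℂ, y 0 ≠ 0 ∧ y 1 ≠ 0 ∧ y 2 ≠ 0 ∧ RelV v (sl (y 0) (y 1) (y 2)) ∧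
      ∀ i, eval v (pn i) = th y i * eval v pd := by
  simp only [map_mul, mul_ne_zero_iff] at h
  obtain ⟨⟨⟨h1, h2⟩, h3⟩, h4⟩ := h
  rw [ev_pd] at h1
  rw [ev_pD] at h2
  rw [ev_pn0] at h3
  rw [ev_pn2] at h4
  obtain ⟨m, r, s, hm, hr, hs, hR⟩ := reduce v h1 h2 h3 h4
  refine ⟨![m, r, s], hm, hr, hs, hR, fun i => ?_⟩
  have k := sl_ev ![m, r, s] hm hr hs i
  obtain ⟨g, h, t, e⟩ := hR
  have e' : sl (![m, r, s] 0) (![m, r, s] 1) (![m, r, s] 2) = act g h t v := e.symm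
  rw [e', (act_ev g h t v).1, (act_ev g h t v).2] at k
  have ht : ((t:ℂ)^2)^24 ≠ 0 := pow_ne_zero _ (pow_ne_zero _ t.ne_zero)
  apply mul_left_cancel₀ ht
  rw [k]; ring

lemma pt_ne : eval (sl (1:ℂ) 1 1) pd ≠ 0 ∧ eval (sl (1:ℂ) 1 1) pD ≠ 0 := by
  rw [ev_pd, ev_pD]; exact slice_pt

lemma gen_ne : pd * pD * pn 0 * pn 2 ≠ 0 := by
  intro h
  have h' := congrArg (eval (sl (1:ℂ) 1 1)) h
  have a0 := sl_ev (fun _ => 1) one_ne_zero one_ne_zero one_ne_zero 0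
  have a2 := sl_ev (fun _ => 1) one_ne_zero one_ne_zero one_ne_zero 2
  simp only [map_mul, map_zero] at h'
  simp only [th, Matrix.cons_val] at a0 a2
  rw [a0, a2] at h'
  simp [pt_ne.1, pt_ne.2] at h'

lemma pd_ne : pd ≠ 0 := by
  intro h; apply gen_ne; simp [h]

lemma eq_of_generic {σ : Type*} (G p q : MvPolynomial σ ℂ) (hG : G ≠ 0)
    (h : ∀ v, eval v G ≠ 0 → eval v p = eval v q) : p = q := by
  apply mul_left_cancel₀ hG
  apply MvPolynomial.funext
  intro v
  rw [map_mul, map_mul]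
  by_cases hv : eval v G = 0
  · simp [hv]
  · rw [h v hv]

lemma clear_den (P : S3) : ∃ (N : ℕ) (Pt : RR),
    algebraMap RR KK Pt = (algebraMap RR KK pd)^N * aeval uu P ∧
    ∀ (v : VV) (y : Fin 3 → ℂ), (∀ i, eval v (pn i) = y i * eval v pd) →
      eval v Pt = (eval v pd)^N * eval y P := by
  have hd : algebraMap RR KK pd ≠ 0 := fun h =>
    pd_ne ((map_eq_zero_iff _ (IsFractionRing.injective RR KK)).mp h)
  induction P using MvPolynomial.induction_on with
  | C a => exact ⟨0, C a, by
      rw [pow_zero, one_mul, aeval_C, IsScalarTower.algebraMap_apply ℂ RR KK]; rfl, by simp⟩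
  | add p q hp hq =>
    obtain ⟨N, Pt, h1, h2⟩ := hp
    obtain ⟨M, Qt, h3, h4⟩ := hq
    refine ⟨N + M, Pt * pd^M + Qt * pd^N, ?_, fun v y h => ?_⟩
    · rw [map_add, map_mul, map_mul, map_pow, map_pow, h1, h3, map_add]; ring
    · rw [map_add, map_mul, map_mul, map_pow, map_pow, h2 v y h, h4 v y h, map_add]; ring
  | mul_X p i hp =>
    obtain ⟨N, Pt, h1, h2⟩ := hp
    refine ⟨N + 1, Pt * pn i, ?_, fun v y h => ?_⟩
    · rw [map_mul, h1, map_mul, aeval_X, uu]; field_simp; ring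
    · rw [map_mul, h2 v y h, h i, map_mul, eval_X]; ring

def slHom : RR →ₐ[ℂ] S3 := aeval (sl (X 0) (X 1) (X 2))
def swHom : S3 →ₐ[ℂ] S3 := aeval ![X 0, X 2, X 1]
def thHom : S3 →ₐ[ℂ] S3 := aeval ![X 0, X 1 + X 2, X 1 * X 2]

lemma ev_slHom (y : Fin 3 → ℂ) (f : RR) :
    eval y (slHom f) = eval (sl (y 0) (y 1) (y 2)) f := by
  induction f using MvPolynomial.induction_on with
  | C a => simp [slHom]
  | add p q hp hq => simp [hp, hq]
  | mul_X p i hp =>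
    rw [map_mul, map_mul, hp, map_mul]
    congr 1
    obtain ⟨r, i⟩ := i
    fin_cases r <;> fin_cases i <;> simp [slHom, sl, slF, slG]

lemma ev_swHom (y : Fin 3 → ℂ) (f : S3) :
    eval y (swHom f) = eval ![y 0, y 2, y 1] f := by
  induction f using MvPolynomial.induction_on with
  | C a => simp [swHom]
  | add p q hp hq => simp [hp, hq]
  | mul_X p i hp =>
    rw [map_mul, map_mul, hp, map_mul]
    congr 1
    fin_cases i <;> simp [swHom]

lemma ev_thHom (y : Fin 3 → ℂ) (f : S3) :
    eval y (thHom f) = eval (th y) f := by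
  induction f using MvPolynomial.induction_on with
  | C a => simp [thHom]
  | add p q hp hq => simp [hp, hq]
  | mul_X p i hp =>
    rw [map_mul, map_mul, hp, map_mul]
    congr 1
    fin_cases i <;> simp [thHom, th]

lemma sw_th (f : S3) : swHom (thHom f) = thHom f := by
  apply MvPolynomial.funext
  intro y
  rw [ev_swHom, ev_thHom, ev_thHom]
  congr 2
  simp [th, add_comm, mul_comm]

lemma th_inj (f : S3) (h : thHom f = 0) : f = 0 := by
  apply MvPolynomial.funext
  intro y
  obtain ⟨e, he⟩ := IsAlgClosed.exists_pow_nat_eq (y 1 ^2 - 4 * y 2) (n := 2) (by norm_num)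
  have := congrArg (eval ![y 0, (y 1 + e)/2, (y 1 - e)/2]) h
  rw [ev_thHom] at this
  have e : th ![y 0, (y 1 + e)/2, (y 1 - e)/2] = y := by
    funext i
    fin_cases i
    · simp [th]
    · simp [th]; ring
    · simp [th]; linear_combination (-1/4) * he
  rwa [e, map_zero] at this

lemma decomp (f : S3) : ∃ a b : S3, f = thHom a + (X 1 - X 2) * thHom b := by
  have t0 : thHom (X 0) = X 0 := by simp [thHom]
  have t1 : thHom (X 1) = X 1 + X 2 := by simp [thHom]
  have t2 : thHom (X 2) = X 1 * X 2 := by simp [thHom]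
  have c2 : (C (1/2 : ℂ) : S3) * 2 = 1 := by
    rw [show (2 : S3) = C 2 from (map_ofNat C 2).symm, ← C_mul]; norm_num
  have tc : thHom (C (1/2)) = C (1/2) := by simp [thHom]
  induction f using MvPolynomial.induction_on with
  | C a => exact ⟨C a, 0, by simp [thHom]⟩
  | add p q hp hq =>
    obtain ⟨a, b, h⟩ := hp
    obtain ⟨a', b', h'⟩ := hq
    exact ⟨a + a', b + b', by rw [h, h', map_add, map_add]; ring⟩
  | mul_X p i hp =>
    obtain ⟨a, b, h⟩ := hp
    fin_cases i
    · refine ⟨a * X 0, b * X 0, ?_⟩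
      simp only [map_mul, t0, h, Fin.mk_zero, Fin.zero_eta]; ring
    · refine ⟨C (1/2) * (a * X 1 + b * (X 1^2 - 4 * X 2)), C (1/2) * (a + b * X 1), ?_⟩
      simp only [map_mul, map_add, map_sub, map_pow, t1, t2, tc, h, map_ofNat, Fin.mk_one]
      linear_combination (-(X 1 * (thHom a + (X 1 - X 2) * thHom b))) * c2
    · refine ⟨C (1/2) * (a * X 1 - b * (X 1^2 - 4 * X 2)), C (1/2) * (b * X 1 - a), ?_⟩
      simp only [map_mul, map_add, map_sub, map_pow, t1, t2, tc, h, map_ofNat, Fin.reduceFinMk]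
      linear_combination (-(X 2 * (thHom a + (X 1 - X 2) * thHom b))) * c2

lemma sym_poly (f : S3) (h : swHom f = f) : ∃ a, f = thHom a := by
  obtain ⟨a, b, hab⟩ := decomp f
  have s1 : swHom (X 1) = X 2 := by simp [swHom]
  have s2 : swHom (X 2) = X 1 := by simp [swHom]
  have h' := h
  rw [hab, map_add, map_mul, map_sub, s1, s2, sw_th, sw_th] at h'
  have h2 : (2 : S3) * ((X 1 - X 2) * thHom b) = 0 := by linear_combination -h'
  rcases mul_eq_zero.1 h2 with h3 | h3
  · exact absurd h3 two_ne_zero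
  · exact ⟨a, by rw [hab, h3, add_zero]⟩

lemma uu_mem (i : Fin 3) : uu i ∈ invFieldAB 1 4 := by
  refine ⟨pn i, pd, pd_ne, rfl, fun γ => ?_⟩
  apply MvPolynomial.funext
  intro v
  rw [map_mul, map_mul, eval_coordHom, eval_coordHom, (act_ev _ _ _ v).1, (act_ev _ _ _ v).2]
  ring

lemma y3_ne : (X 0 * X 1 * X 2 : S3) ≠ 0 :=
  mul_ne_zero (mul_ne_zero (X_ne_zero _) (X_ne_zero _)) (X_ne_zero _)

lemma y3_ev (y : Fin 3 → ℂ) (h : eval y (X 0 * X 1 * X 2 : S3) ≠ 0) :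
    y 0 ≠ 0 ∧ y 1 ≠ 0 ∧ y 2 ≠ 0 := by
  simp only [map_mul, eval_X, mul_ne_zero_iff] at h
  exact ⟨h.1.1, h.1.2, h.2⟩

lemma slpd_ne : slHom pd ≠ 0 := by
  intro h
  have := congrArg (eval (fun _ => (1:ℂ))) h
  rw [ev_slHom, map_zero] at this
  exact pt_ne.1 this

lemma uu_inj : Function.Injective (aeval uu : S3 →ₐ[ℂ] KK) := by
  rw [injective_iff_map_eq_zero]
  intro P hP
  obtain ⟨N, Pt, h1, h2⟩ := clear_den P
  rw [hP, mul_zero, map_eq_zero_iff _ (IsFractionRing.injective RR KK)] at h1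
  apply th_inj
  apply eq_of_generic (X 0 * X 1 * X 2 * slHom pd) _ _ (mul_ne_zero y3_ne slpd_ne)
  intro y hy
  rw [map_mul, mul_ne_zero_iff] at hy
  obtain ⟨a, b, c⟩ := y3_ev y hy.1
  have k := h2 (sl (y 0) (y 1) (y 2)) (th y) (fun i => sl_ev y a b c i)
  rw [h1, map_zero] at k
  have hy2 := hy.2
  rw [ev_slHom] at hy2
  rw [ev_thHom, map_zero]
  exact (mul_eq_zero.1 k.symm).resolve_left (pow_ne_zero _ hy2)

lemma coord_inj (g h : SL2) (t : ℂˣ) (f : RR) (hf : coordHomAB 1 4 g h t f = 0) : f = 0 := by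
  apply MvPolynomial.funext
  intro v
  have := congrArg (eval (act g⁻¹ h⁻¹ t⁻¹ v)) hf
  rw [eval_coordHom, act_act] at this
  simpa [act_one] using this

lemma sw_sw (f : S3) : swHom (swHom f) = f := by
  apply MvPolynomial.funext
  intro y
  rw [ev_swHom, ev_swHom]
  congr 2
  funext i; fin_cases i <;> simp

lemma surj (x : KK) (hx : x ∈ invFieldAB 1 4) :
    ∃ P Q : S3, Q ≠ 0 ∧ x = aeval uu P / aeval uu Q := by
  obtain ⟨f0, g0, hg0, rfl, hinv0⟩ := hx
  obtain ⟨f, g, c, hrel, rfl, rfl⟩ := UniqueFactorizationMonoid.exists_reduced_factors' f0 g0 hg0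
  obtain ⟨hc, hg⟩ := mul_ne_zero_iff.1 hg0
  have hinv : ∀ γ h t, coordHomAB 1 4 γ h t f * g = coordHomAB 1 4 γ h t g * f := by
    intro γ h t
    have k := hinv0 (γ, h, t)
    simp only [map_mul] at k
    have hc' : coordHomAB 1 4 γ h t c ≠ 0 := fun e => hc (coord_inj _ _ _ _ e)
    apply mul_left_cancel₀ (mul_ne_zero hc' hc)
    linear_combination k
  have hR : ∀ v w, RelV v w → eval w f * eval v g = eval w g * eval v f := by
    rintro v w ⟨γ, h, t, rfl⟩
    have k := congrArg (eval v) (hinv γ h t)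
    rwa [map_mul, map_mul, eval_coordHom, eval_coordHom] at k
  have hz : ∀ v w, RelV v w → eval v g = 0 → eval w g = 0 := by
    rintro v w ⟨γ, h, t, rfl⟩ hv
    have k : g ∣ coordHomAB 1 4 γ h t g :=
      hrel.symm.dvd_of_dvd_mul_right (Dvd.intro_left _ (hinv γ h t))
    obtain ⟨q, hq⟩ := k
    rw [← eval_coordHom, hq, map_mul, hv, zero_mul]
  have hsg : slHom g ≠ 0 := by
    intro h
    apply hg
    apply eq_of_generic _ _ _ gen_ne
    intro v hv
    obtain ⟨y, -, -, -, hy, -⟩ := generic v hv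
    rw [map_zero]
    refine hz _ _ hy.symm ?_
    rw [← ev_slHom, h, map_zero]
  have hsg' : swHom (slHom g) ≠ 0 := by
    intro h
    apply hsg
    rw [← sw_sw (slHom g), h, map_zero]
  have hQ : swHom (slHom g * swHom (slHom g)) = slHom g * swHom (slHom g) := by
    rw [map_mul, sw_sw, mul_comm]
  have hP : swHom (slHom f * swHom (slHom g)) = slHom f * swHom (slHom g) := by
    rw [map_mul, sw_sw]
    apply eq_of_generic _ _ _ y3_ne
    intro y hy
    obtain ⟨a, b, d⟩ := y3_ev y hy
    have k := hR _ _ (sl_swap (y 0) (y 1) (y 2) a b d)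
    simp only [map_mul, ev_swHom, ev_slHom]
    simp only [Matrix.cons_val]
    rw [k, mul_comm]
  obtain ⟨P, eP⟩ := sym_poly _ hP
  obtain ⟨Q, eQ⟩ := sym_poly _ hQ
  have hQ0 : Q ≠ 0 := by
    rintro rfl
    rw [map_zero] at eQ
    exact mul_ne_zero hsg hsg' eQ
  refine ⟨P, Q, hQ0, ?_⟩
  obtain ⟨N, Pt, p1, p2⟩ := clear_den P
  obtain ⟨M, Qt, q1, q2⟩ := clear_den Q
  have key : f * Qt * pd^N = g * Pt * pd^M := by
    apply eq_of_generic _ _ _ gen_ne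
    intro v hv
    obtain ⟨y, -, -, -, hy, hth⟩ := generic v hv
    have k := hR _ _ hy
    have a := congrArg (eval y) eP
    have b := congrArg (eval y) eQ
    rw [map_mul, ev_slHom, ev_thHom] at a b
    simp only [map_mul, map_pow]
    rw [p2 v _ hth, q2 v _ hth, ← a, ← b]
    linear_combination (-(eval v pd)^M * (eval v pd)^N * eval y (swHom (slHom g))) * k
  have inj := IsFractionRing.injective RR KK
  have hd : algebraMap RR KK pd ≠ 0 := fun h => pd_ne ((map_eq_zero_iff _ inj).mp h)
  have hgK : algebraMap RR KK g ≠ 0 := fun h => hg ((map_eq_zero_iff _ inj).mp h)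
  have hcK : algebraMap RR KK c ≠ 0 := fun h => hc ((map_eq_zero_iff _ inj).mp h)
  have hQK : aeval uu Q ≠ 0 := fun h => hQ0 ((map_eq_zero_iff _ uu_inj).mp h)
  have key' := congrArg (algebraMap RR KK) key
  simp only [map_mul, map_pow] at key'
  rw [p1, q1] at key'
  rw [map_mul, map_mul, mul_div_mul_left _ _ hcK, div_eq_div_iff hgK hQK]
  apply mul_left_cancel₀ (mul_ne_zero (pow_ne_zero M hd) (pow_ne_zero N hd))
  linear_combination key'

lemma aeval_mem (P : S3) : aeval uu P ∈ invFieldAB 1 4 := by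
  induction P using MvPolynomial.induction_on with
  | C a => rw [aeval_C]; exact (invFieldAB 1 4).algebraMap_mem a
  | add p q hp hq => rw [map_add]; exact add_mem hp hq
  | mul_X p i hp => rw [map_mul, aeval_X]; exact mul_mem hp (uu_mem i)

def psi : FractionRing S3 →ₐ[ℂ] KK := IsFractionRing.liftAlgHom uu_inj

lemma psi_alg (P : S3) : psi (algebraMap S3 (FractionRing S3) P) = aeval uu P :=
  IsFractionRing.lift_algebraMap uu_inj P

lemma psi_mem (z : FractionRing S3) : psi z ∈ invFieldAB 1 4 := by
  obtain ⟨P, Q, -, rfl⟩ := IsFractionRing.div_surjective (A := S3) z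
  rw [map_div₀, psi_alg, psi_alg]
  exact div_mem (aeval_mem P) (aeval_mem Q)

theorem main_aux :
    Nonempty ((invFieldAB 1 4) ≃ₐ[ℂ] FractionRing (MvPolynomial (Fin 3) ℂ)) := by
  refine ⟨(AlgEquiv.ofBijective
    (psi.codRestrict (invFieldAB 1 4).toSubalgebra psi_mem) ⟨?_, ?_⟩).symm⟩
  · intro a b h
    exact psi.toRingHom.injective (congrArg Subtype.val h)
  · rintro ⟨x, hx⟩
    obtain ⟨P, Q, -, rfl⟩ := surj x hx
    refine ⟨algebraMap S3 _ P / algebraMap S3 _ Q, Subtype.ext ?_⟩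
    change psi _ = _
    rw [map_div₀, psi_alg, psi_alg]

/-- **Rationality of `P(V_{1,4}) / (SL₂(ℂ) × SL₂(ℂ))`**: the field of invariant rational
functions is purely transcendental over `ℂ` of transcendence degree 3. -/
theorem quotient_rational_1_4 :
    Nonempty ((invFieldAB 1 4) ≃ₐ[ℂ] FractionRing (MvPolynomial (Fin 3) ℂ)) := by
  exact main_aux
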